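/- Define rational functions F n j ∈ ℚ(z) (for 1 ≤ j ≤ n−1) by F n j = (−1)^(j−1) · z^j · (r (n−j))(z²) / ((r n)(z²) + 2·z² · (r (n−1))(z²)), where (r k)(z²) denotes the polynomial r k composed with z². Then this family satisfies the defining recurrences of the path-count generating functions: F 2 1 = z; for every n ≥ 3, F n 1 = z · (1 − 2z · F (n−1) 1) / (1 − z · F (n−1) 1); and for every n ≥ 3 and 2 ≤ j ≤ n−1, F n j = F (n−1) (j−1) · (F n 1 − 2z). -/

import Mathlib

open Polynomial

/-- The polynomials `r k ∈ ℚ[X]` defined by `r 0 = 0`, `r 1 = 1`,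
`r (k+2) = (1 - 2X) r (k+1) + X r k`. -/
noncomputable def r : ℕ → Polynomial ℚ
  | 0 => 0
  | 1 => 1
  | (k + 2) => (1 - 2 * X) * r (k + 1) + X * r k

/-- The rational functions `F n j = (-1)^(j-1) z^j r_{n-j}(z²) / (r_n(z²) + 2z² r_{n-1}(z²))`
in `ℚ(z)`; these are the path-count generating functions `f_j^{(n)}`. -/
noncomputable def F (n j : ℕ) : RatFunc ℚ :=
  (-1) ^ (j - 1) * RatFunc.X ^ j *
      algebraMap (Polynomial ℚ) (RatFunc ℚ) ((r (n - j)).comp (X ^ 2)) /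
    algebraMap (Polynomial ℚ) (RatFunc ℚ)
      ((r n).comp (X ^ 2) + 2 * X ^ 2 * (r (n - 1)).comp (X ^ 2))

/-- The image of `r k (z²)` in `ℚ(z)`. -/
noncomputable def rSq (k : ℕ) : RatFunc ℚ :=
  algebraMap (Polynomial ℚ) (RatFunc ℚ) ((r k).comp (X ^ 2))

theorem rSq_add_two (k : ℕ) :
    rSq (k + 2) = (1 - 2 * RatFunc.X ^ 2) * rSq (k + 1) + RatFunc.X ^ 2 * rSq k := by
  simp [rSq, r, RatFunc.algebraMap_X, map_ofNat (algebraMap ℚ[X] (RatFunc ℚ)) 2]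

theorem eval_zero_r_succ (k : ℕ) : (r (k + 1)).eval 0 = 1 := by
  induction k with
  | zero => simp [r]
  | succ k ih => simp [r, ih]

theorem rSq_add_two_mul_ne_zero (k : ℕ) :
    rSq (k + 1) + 2 * RatFunc.X ^ 2 * rSq k ≠ 0 := by
  have hp : (r (k + 1)).comp (X ^ 2) + 2 * X ^ 2 * (r k).comp (X ^ 2) ≠ 0 := by
    intro h
    simpa [eval_comp, eval_zero_r_succ] using congrArg (eval 0) h
  simpa [rSq, RatFunc.algebraMap_X, map_ofNat (algebraMap ℚ[X] (RatFunc ℚ)) 2] using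
    RatFunc.algebraMap_ne_zero hp

theorem F_eq_rSq (n j : ℕ) :
    F n j = (-1) ^ (j - 1) * RatFunc.X ^ j * rSq (n - j) /
      (rSq n + 2 * RatFunc.X ^ 2 * rSq (n - 1)) := by
  simp [F, rSq, RatFunc.algebraMap_X, map_ofNat (algebraMap ℚ[X] (RatFunc ℚ)) 2]

/-- The family `F n j` satisfies the defining recurrences of the path-count
generating functions: `F 2 1 = z`; `F n 1 = z (1 - 2z F (n-1) 1)/(1 - z F (n-1) 1)`
for `n ≥ 3`; and `F n j = F (n-1) (j-1) (F n 1 - 2z)` for `n ≥ 3`, `2 ≤ j ≤ n-1`. -/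
theorem F_satisfies_recurrences :
    F 2 1 = RatFunc.X ∧
    (∀ n : ℕ, 3 ≤ n →
      F n 1 = RatFunc.X * (1 - 2 * RatFunc.X * F (n - 1) 1) /
        (1 - RatFunc.X * F (n - 1) 1)) ∧
    (∀ n : ℕ, 3 ≤ n → ∀ j : ℕ, 2 ≤ j → j ≤ n - 1 →
      F n j = F (n - 1) (j - 1) * (F n 1 - 2 * RatFunc.X)) := by
  refine ⟨?_, fun n hn => ?_, fun n hn j hj hjn => ?_⟩
  · simp [F, r]
  · obtain ⟨k, rfl⟩ := Nat.exists_eq_add_of_le' hn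
    have h₁ := rSq_add_two_mul_ne_zero (k + 2)
    have h₂ := rSq_add_two_mul_ne_zero (k + 1)
    have e := rSq_add_two (k + 1)
    simp only [F_eq_rSq, Nat.reduceSubDiff, Nat.sub_self, pow_zero,
      pow_one, one_mul, Nat.add_assoc, Nat.reduceAdd] at *
    have hden : 1 - RatFunc.X * (RatFunc.X * rSq (k + 1) /
        (rSq (k + 2) + 2 * RatFunc.X ^ 2 * rSq (k + 1))) =
        (rSq (k + 3) + 2 * RatFunc.X ^ 2 * rSq (k + 2)) /
        (rSq (k + 2) + 2 * RatFunc.X ^ 2 * rSq (k + 1)) := by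
      rw [eq_div_iff h₂, sub_mul, ← mul_div_assoc, div_mul_cancel₀ _ h₂, e]
      ring
    have hnum : 1 - 2 * RatFunc.X * (RatFunc.X * rSq (k + 1) /
        (rSq (k + 2) + 2 * RatFunc.X ^ 2 * rSq (k + 1))) =
        rSq (k + 2) / (rSq (k + 2) + 2 * RatFunc.X ^ 2 * rSq (k + 1)) := by
      rw [eq_div_iff h₂, sub_mul, ← mul_div_assoc, div_mul_cancel₀ _ h₂]
      ring
    rw [hden, hnum, ← mul_div_assoc, div_div_div_cancel_right₀ h₂]
  · obtain ⟨k, rfl⟩ := Nat.exists_eq_add_of_le' hn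
    obtain ⟨i, rfl⟩ := Nat.exists_eq_add_of_le' hj
    have h₁ := rSq_add_two_mul_ne_zero (k + 2)
    have h₂ := rSq_add_two_mul_ne_zero (k + 1)
    have e := rSq_add_two (k + 1)
    simp only [F_eq_rSq, Nat.reduceSubDiff, Nat.sub_self, pow_zero,
      pow_one, one_mul, Nat.add_assoc, Nat.reduceAdd] at *
    have hsub : RatFunc.X * rSq (k + 2) / (rSq (k + 3) + 2 * RatFunc.X ^ 2 * rSq (k + 2)) -
        2 * RatFunc.X =
        -RatFunc.X * (rSq (k + 2) + 2 * RatFunc.X ^ 2 * rSq (k + 1)) /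
        (rSq (k + 3) + 2 * RatFunc.X ^ 2 * rSq (k + 2)) := by
      rw [eq_div_iff h₁, sub_mul, div_mul_cancel₀ _ h₁, e]
      ring
    rw [hsub, div_mul_div_comm, div_eq_div_iff h₁ (mul_ne_zero h₂ h₁)]
    ring
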